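/- For every integer d ≥ 1, the function f_d(x) := (∑_{j=1}^d ψ((x−j+1)/2)) − d·log(x/2) + x·d/(x−d−1) is completely monotone on (d+1, ∞): for every natural number k and every real x > d+1, the k-th derivative satisfies (−1)^k · f_d^{(k)}(x) > 0 (in particular f_d > 0, f_d′ < 0, f_d′′ > 0, etc. on (d+1, ∞)). -/

import Mathlib

/-- The digamma function `ψ(x) = (log Γ)'(x)`. -/
noncomputable def digamma (x : ℝ) : ℝ := deriv (fun t => Real.log (Real.Gamma t)) x

/-- `f_d(x) = ∑_{j=1}^d ψ((x-j+1)/2) - d log(x/2) + x d/(x-d-1)`. -/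
noncomputable def fFun (d : ℕ) (x : ℝ) : ℝ :=
  (∑ j ∈ Finset.Icc 1 d, digamma ((x - j + 1) / 2)) - d * Real.log (x / 2)
    + x * d / (x - d - 1)

open Real Set Filter Topology

/-- `F k` is `(-1)^k` times the `k`-th derivative of `F 0` on `(a, ∞)`. -/
def DSeq (a : ℝ) (F : ℕ → ℝ → ℝ) : Prop :=
  ∀ k x, a < x → HasDerivAt (F k) (-(F (k + 1) x)) x

lemma DSeq.add {a : ℝ} {F G : ℕ → ℝ → ℝ} (hF : DSeq a F) (hG : DSeq a G) :
    DSeq a (fun k x => F k x + G k x) := by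
  intro k x hx
  have := (hF k x hx).add (hG k x hx)
  exact this.congr_deriv (by ring)

lemma DSeq.sub {a : ℝ} {F G : ℕ → ℝ → ℝ} (hF : DSeq a F) (hG : DSeq a G) :
    DSeq a (fun k x => F k x - G k x) := by
  intro k x hx
  have := (hF k x hx).sub (hG k x hx)
  exact this.congr_deriv (by ring)

lemma DSeq.smul {a : ℝ} {F : ℕ → ℝ → ℝ} (c : ℝ) (hF : DSeq a F) :
    DSeq a (fun k x => c * F k x) := by
  intro k x hx
  have := (hF k x hx).const_mul c
  exact this.congr_deriv (by ring)

lemma DSeq.sum {a : ℝ} {s : Finset ℕ} {F : ℕ → ℕ → ℝ → ℝ} (hF : ∀ j ∈ s, DSeq a (F j)) :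
    DSeq a (fun k x => ∑ j ∈ s, F j k x) := by
  intro k x hx
  have := HasDerivAt.fun_sum (u := s) (fun j hj => hF j hj k x hx)
  exact this.congr_deriv (by rw [Finset.sum_neg_distrib])

/-- derivative sequence of `1/(x+c)` -/
noncomputable def recSeq (c : ℝ) (k : ℕ) (x : ℝ) : ℝ := (k.factorial : ℝ) / (x + c) ^ (k + 1)

/-- derivative sequence of `log (x+c)` -/
noncomputable def logSeq (c : ℝ) : ℕ → ℝ → ℝ
  | 0 => fun x => Real.log (x + c)
  | (k + 1) => fun x => -recSeq c k x

/-- derivative sequence of a constant -/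
noncomputable def constSeq (c : ℝ) : ℕ → ℝ → ℝ
  | 0 => fun _ => c
  | (_ + 1) => fun _ => 0

lemma constSeq_dseq (a c : ℝ) : DSeq a (constSeq c) := by
  intro k x hx
  cases k with
  | zero => simpa [constSeq] using hasDerivAt_const x c
  | succ k => simpa [constSeq] using hasDerivAt_const x (0 : ℝ)

lemma recSeq_dseq (a c : ℝ) (h : 0 ≤ a + c) : DSeq a (recSeq c) := by
  intro k x hx
  have hp : 0 < x + c := by linarith
  have h1 : HasDerivAt (fun x : ℝ => (x + c) ^ (k + 1)) (((k + 1 : ℕ) : ℝ) * (x + c) ^ k * 1) x := by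
    exact ((hasDerivAt_id x).add_const c).pow (k + 1)
  have h2 := (hasDerivAt_const x (k.factorial : ℝ)).div h1 (by positivity)
  refine h2.congr_deriv ?_
  simp only [recSeq, Nat.factorial_succ]
  push_cast
  field_simp
  ring

lemma logSeq_dseq (a c : ℝ) (h : 0 ≤ a + c) : DSeq a (logSeq c) := by
  intro k x hx
  have hp : 0 < x + c := by linarith
  cases k with
  | zero =>
    have := ((hasDerivAt_id x).add_const c).log hp.ne'
    simpa [logSeq, recSeq] using this
  | succ k =>
    exact (recSeq_dseq a c h k x hx).neg

lemma DSeq.iteratedDeriv {a : ℝ} {F : ℕ → ℝ → ℝ} (hF : DSeq a F) {f : ℝ → ℝ}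
    (hf : ∀ x, a < x → f x = F 0 x) (k : ℕ) :
    ∀ x, a < x → iteratedDeriv k f x = (-1) ^ k * F k x := by
  induction k with
  | zero => intro x hx; simp [hf x hx]
  | succ k ih =>
    intro x hx
    rw [iteratedDeriv_succ]
    have : _root_.iteratedDeriv k f =ᶠ[𝓝 x] fun x => (-1) ^ k * F k x := by
      filter_upwards [Ioi_mem_nhds hx] with y hy using ih y hy
    rw [this.deriv_eq, ((hF k x hx).const_mul _).deriv]
    ring

lemma DSeq.affine {F : ℕ → ℝ → ℝ} (hF : DSeq 0 F) (c : ℝ) {a : ℝ} (h : 0 ≤ a + c) :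
    DSeq a (fun k x => F k ((x + c) / 2) / 2 ^ k) := by
  intro k x hx
  have h1 : HasDerivAt (fun x : ℝ => (x + c) / 2) (1 / 2) x :=
    ((hasDerivAt_id x).add_const c).div_const 2
  have h2 := ((hF k ((x + c) / 2) (by linarith)).comp x h1).div_const (2 ^ k)
  refine h2.congr_deriv ?_
  simp only [pow_succ]
  field_simp

lemma DSeq.shift {F : ℕ → ℝ → ℝ} (hF : DSeq 0 F) (n : ℝ) (hn : 0 ≤ n) :
    DSeq 0 (fun k x => F k (x + n)) := by
  intro k x hx
  have h1 : HasDerivAt (fun x : ℝ => x + n) 1 x := (hasDerivAt_id x).add_const n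
  have h2 := ((hF k (x + n) (by linarith)).comp x h1)
  exact h2.congr_deriv (by ring)

lemma DSeq.antitone {F : ℕ → ℝ → ℝ} (hF : DSeq 0 F) (h0 : ∀ k x, 0 < x → 0 ≤ F k x) (k : ℕ) :
    AntitoneOn (F k) (Ioi 0) := by
  apply antitoneOn_of_deriv_nonpos (convex_Ioi 0)
  · intro x hx
    exact (hF k x hx).continuousAt.continuousWithinAt
  · intro x hx
    rw [interior_Ioi] at hx
    exact (hF k x hx).differentiableAt.differentiableWithinAt
  · intro x hx
    rw [interior_Ioi] at hx
    rw [(hF k x hx).deriv]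
    have := h0 (k + 1) x hx
    linarith

lemma DSeq.bound {F : ℕ → ℝ → ℝ} (hF : DSeq 0 F) (h0 : ∀ k x, 0 < x → 0 ≤ F k x) (k : ℕ)
    (e : ℝ) (he : 0 < e) : F (k + 1) e ≤ F k (e / 2) * (2 / e) := by
  obtain ⟨c, hc, hc'⟩ := exists_hasDerivAt_eq_slope (F k) (fun x => -(F (k + 1) x))
    (show e / 2 < e by linarith)
    (fun x hx => (hF k x (by have := hx.1; linarith)).continuousAt.continuousWithinAt)
    (fun x hx => hF k x (by have := hx.1; linarith))
  have hc0 : 0 < c := by have := hc.1; linarith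
  have h1 := hF.antitone h0 (k + 1) (mem_Ioi.2 hc0) (mem_Ioi.2 he) hc.2.le
  have h2 := h0 k e he
  have h3 : F (k + 1) c = (F k (e / 2) - F k e) * (2 / e) := by
    have : F (k + 1) c = -((F k e - F k (e / 2)) / (e - e / 2)) := by rw [← hc']; ring
    rw [this]
    have : e - e / 2 = e / 2 := by ring
    rw [this]
    field_simp
    ring
  have h4 : 0 < 2 / e := by positivity
  nlinarith

lemma DSeq.tsum {u : ℕ → ℕ → ℝ → ℝ} (hu : ∀ n, DSeq 0 (u n))
    (h0 : ∀ n k x, 0 < x → 0 ≤ u n k x) (hs : ∀ x, 0 < x → Summable fun n => u n 0 x) :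
    DSeq 0 (fun k x => ∑' n, u n k x) := by
  have hs' : ∀ k x, 0 < x → Summable fun n => u n k x := by
    intro k
    induction k with
    | zero => exact hs
    | succ k ih =>
      intro x hx
      exact Summable.of_nonneg_of_le (fun n => h0 n _ x hx)
        (fun n => (hu n).bound (h0 n) k x hx) ((ih (x / 2) (by linarith)).mul_right _)
  intro k x hx
  have hx2 : 0 < x / 2 := by linarith
  have := hasDerivAt_tsum_of_isPreconnected (g := fun n => u n k)
    (g' := fun n y => -(u n (k + 1) y)) (t := Ioi (x / 2)) (y₀ := x) (y := x)
    (hs' (k + 1) (x / 2) hx2) isOpen_Ioi isPreconnected_Ioi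
    (fun n y hy => hu n k y (hx2.trans hy))
    (fun n y hy => by
      have hy0 : 0 < y := hx2.trans hy
      rw [norm_neg, Real.norm_of_nonneg (h0 n _ y hy0)]
      exact (hu n).antitone (h0 n) (k + 1) (mem_Ioi.2 hx2) (mem_Ioi.2 hy0) (le_of_lt hy))
    (mem_Ioi.2 (by linarith)) (hs' k x hx) (mem_Ioi.2 (by linarith))
  rw [tsum_neg] at this
  exact this

/-- `log(y+1) - log y - 1/(y+1)` -/
noncomputable def deltaSeq (k : ℕ) (y : ℝ) : ℝ := logSeq 1 k y - logSeq 0 k y - recSeq 1 k y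

lemma deltaSeq_dseq : DSeq 0 deltaSeq :=
  ((logSeq_dseq 0 1 (by norm_num)).sub (logSeq_dseq 0 0 (by norm_num))).sub
    (recSeq_dseq 0 1 (by norm_num))

lemma deltaSeq_nonneg (k : ℕ) (y : ℝ) (hy : 0 < y) : 0 ≤ deltaSeq k y := by
  cases k with
  | zero =>
    simp only [deltaSeq, logSeq, recSeq]
    have h := Real.one_sub_inv_le_log_of_pos (show 0 < (y + 1) / y by positivity)
    rw [Real.log_div (by positivity) (by positivity)] at h
    have : 1 - ((y + 1) / y)⁻¹ = 1 / (y + 1) := by field_simp; ring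
    simp
    rw [this] at h
    simp at h
    linarith
  | succ k =>
    simp only [deltaSeq, logSeq, recSeq]
    have hb := one_add_mul_le_pow (a := 1 / y) (by have : 0 < 1 / y := by positivity
                                                   linarith) (k + 1)
    have h1 : (1 : ℝ) + 1 / y = (y + 1) / y := by field_simp
    rw [h1, div_pow, le_div_iff₀ (by positivity)] at hb
    have h2 : ((k : ℝ) + 1) / (y + 1) ≤ (k + 1) * (1 / y) := by
      rw [div_eq_mul_one_div]
      gcongr
      linarith
    have h3 : (1 + ((k : ℝ) + 1) / (y + 1)) * y ^ (k + 1) ≤ (y + 1) ^ (k + 1) := by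
      refine le_trans ?_ hb
      push_cast
      gcongr
    have h4 : (1 + ((k : ℝ) + 1) / (y + 1)) / (y + 1) ^ (k + 1) ≤ 1 / y ^ (k + 1) := by
      rw [div_le_div_iff₀ (by positivity) (by positivity)]
      linarith
    have h5 := mul_le_mul_of_nonneg_left h4 (show (0 : ℝ) ≤ k.factorial by positivity)
    have h6 : (k.factorial : ℝ) * ((1 + ((k : ℝ) + 1) / (y + 1)) / (y + 1) ^ (k + 1))
        = k.factorial / (y + 1) ^ (k + 1) + ((k + 1).factorial : ℝ) / (y + 1) ^ (k + 1 + 1) := by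
      rw [Nat.factorial_succ]
      push_cast
      field_simp
      ring
    rw [h6, mul_one_div] at h5
    rw [add_zero]
    linarith

/-- `a/y - log(y+a) + log y` -/
noncomputable def gapSeq (a : ℝ) (k : ℕ) (y : ℝ) : ℝ :=
  a * recSeq 0 k y - (logSeq a k y - logSeq 0 k y)

lemma gapSeq_dseq (a : ℝ) (ha : 0 ≤ a) : DSeq 0 (gapSeq a) :=
  ((recSeq_dseq 0 0 (by norm_num)).smul a).sub
    ((logSeq_dseq 0 a (by linarith)).sub (logSeq_dseq 0 0 (by norm_num)))

lemma gapSeq_nonneg (a : ℝ) (ha : 0 ≤ a) (k : ℕ) (y : ℝ) (hy : 0 < y) : 0 ≤ gapSeq a k y := by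
  have hya : 0 < y + a := by linarith
  cases k with
  | zero =>
    simp only [gapSeq, logSeq, recSeq]
    have h := Real.log_le_sub_one_of_pos (show 0 < (y + a) / y by positivity)
    rw [Real.log_div (by positivity) (by positivity)] at h
    have : (y + a) / y - 1 = a / y := by field_simp; ring
    rw [this] at h
    simp only [Nat.factorial, add_zero, zero_add, pow_one, Nat.cast_one, mul_one_div]
    linarith
  | succ k =>
    simp only [gapSeq, logSeq, recSeq]
    have h0 : a / (y + a) ≤ 1 := by rw [div_le_one hya]; linarith
    have hb := one_add_mul_le_pow (a := -(a / (y + a))) (by linarith) (k + 1)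
    have h1 : (1 : ℝ) + -(a / (y + a)) = y / (y + a) := by field_simp; ring
    rw [h1] at hb
    have h2 : a / (y + a) ≤ a / y := by gcongr; linarith
    have h3 : 1 - ((k : ℝ) + 1) * (a / y) ≤ y ^ (k + 1) / (y + a) ^ (k + 1) := by
      rw [← div_pow]
      refine le_trans ?_ hb
      push_cast
      nlinarith [show (0 : ℝ) ≤ (k : ℝ) + 1 by positivity]
    have h5 := mul_le_mul_of_nonneg_left h3
      (show (0 : ℝ) ≤ k.factorial / y ^ (k + 1) by positivity)
    have h6 : (k.factorial : ℝ) / y ^ (k + 1) * (1 - ((k : ℝ) + 1) * (a / y))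
        = k.factorial / y ^ (k + 1) - a * (((k + 1).factorial : ℝ) / y ^ (k + 1 + 1)) := by
      rw [Nat.factorial_succ]
      push_cast
      field_simp
      ring
    have h7 : (k.factorial : ℝ) / y ^ (k + 1) * (y ^ (k + 1) / (y + a) ^ (k + 1))
        = k.factorial / (y + a) ^ (k + 1) := by
      field_simp
    rw [h6, h7] at h5
    rw [add_zero]
    linarith

lemma logGamma_diff (y : ℝ) (hy : 0 < y) :
    DifferentiableAt ℝ (fun t => Real.log (Real.Gamma t)) y :=
  (Real.differentiableAt_Gamma (fun m => by
    have : (0 : ℝ) ≤ m := by positivity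
    linarith)).log (Real.Gamma_pos_of_pos hy).ne'

lemma logGamma_succ (y : ℝ) (hy : 0 < y) :
    Real.log (Real.Gamma (y + 1)) = Real.log y + Real.log (Real.Gamma y) := by
  rw [Real.Gamma_add_one hy.ne', Real.log_mul hy.ne' (Real.Gamma_pos_of_pos hy).ne']

lemma digamma_succ (y : ℝ) (hy : 0 < y) : digamma (y + 1) = digamma y + 1 / y := by
  unfold digamma
  rw [← deriv_comp_add_const]
  have : (fun x => Real.log (Real.Gamma (x + 1))) =ᶠ[𝓝 y]
      fun x => Real.log x + Real.log (Real.Gamma x) := by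
    filter_upwards [Ioi_mem_nhds hy] with x hx using logGamma_succ x hx
  rw [this.deriv_eq,
    ((Real.hasDerivAt_log hy.ne').fun_add (logGamma_diff y hy).hasDerivAt).deriv]
  rw [one_div, add_comm]

lemma digamma_lower (y : ℝ) (hy : 0 < y) : Real.log y ≤ digamma (y + 1) := by
  have h := Real.convexOn_log_Gamma.slope_le_deriv (x := y) (y := y + 1) hy
    (mem_Ioi.2 (by linarith)) (by linarith) (logGamma_diff _ (by linarith))
  simp only [slope_def_field, Function.comp] at h
  rw [logGamma_succ y hy] at h
  simp only [add_sub_cancel_right, add_sub_cancel_left, div_one] at h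
  exact h

lemma digamma_upper (y : ℝ) (hy : 0 < y) : digamma y ≤ Real.log y := by
  have h := Real.convexOn_log_Gamma.deriv_le_slope (x := y) (y := y + 1) hy
    (mem_Ioi.2 (by linarith)) (by linarith) (logGamma_diff _ (by linarith))
  simp only [slope_def_field, Function.comp] at h
  rw [logGamma_succ y hy] at h
  simp only [add_sub_cancel_right, add_sub_cancel_left, div_one] at h
  exact h

lemma digamma_hasSum (y : ℝ) (hy : 0 < y) :
    HasSum (fun n : ℕ => deltaSeq 0 (y + n)) (digamma y + 1 / y - Real.log y) := by
  have hyn : ∀ n : ℕ, 0 < y + n := fun n => by positivity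
  rw [hasSum_iff_tendsto_nat_of_nonneg (fun n => deltaSeq_nonneg 0 _ (hyn n))]
  set h : ℝ → ℝ := fun z => digamma (z + 1) - Real.log z with hh
  have hsum : ∀ N : ℕ, ∑ n ∈ Finset.range N, deltaSeq 0 (y + n) = h y - h (y + N) := by
    intro N
    induction N with
    | zero => simp
    | succ N ih =>
      rw [Finset.sum_range_succ, ih]
      have := digamma_succ (y + N + 1) (by have := hyn N; linarith)
      simp only [hh, deltaSeq, logSeq, recSeq]
      push_cast
      rw [← add_assoc, this]
      simp
      ring
  simp_rw [hsum]
  rw [← digamma_succ y hy]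
  have hlim : Tendsto (fun N : ℕ => h (y + N)) atTop (𝓝 0) := by
    have ht : Tendsto (fun N : ℕ => (y + (N : ℝ))) atTop atTop :=
      tendsto_atTop_add_const_left _ _ tendsto_natCast_atTop_atTop
    refine squeeze_zero (fun N => ?_) (fun N => ?_) (tendsto_inv_atTop_zero.comp ht)
    · have := digamma_lower _ (hyn N)
      simp only [hh]; linarith
    · have h1 := digamma_upper (y + N) (hyn N)
      rw [hh]
      simp only [Function.comp]
      rw [digamma_succ _ (hyn N), one_div]
      linarith
  simpa using (tendsto_const_nhds (x := h y)).sub hlim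

/-- derivative sequence of `ψ(y) + 1/y - log y`. -/
noncomputable def psiSeq (k : ℕ) (y : ℝ) : ℝ := ∑' n : ℕ, deltaSeq k (y + n)

lemma psiSeq_dseq : DSeq 0 psiSeq :=
  DSeq.tsum (u := fun n k y => deltaSeq k (y + n))
    (fun n => deltaSeq_dseq.shift n (by positivity))
    (fun n k x hx => deltaSeq_nonneg k _ (by positivity))
    (fun x hx => (digamma_hasSum x hx).summable)

lemma psiSeq_nonneg (k : ℕ) (y : ℝ) (hy : 0 < y) : 0 ≤ psiSeq k y :=
  tsum_nonneg fun n => deltaSeq_nonneg k _ (by positivity)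

/-- derivative sequence of the `j`-th summand. -/
noncomputable def termSeq (d j : ℕ) (k : ℕ) (x : ℝ) : ℝ :=
  (psiSeq k ((x + (1 - j)) / 2) / 2 ^ k + gapSeq (((j : ℝ) - 1) / 2) k ((x + (1 - j)) / 2) / 2 ^ k)
  + ((d + 1 : ℝ) * recSeq (-d - 1) k x - (j + 1 : ℝ) * recSeq (1 - j) k x) + constSeq 1 k x

lemma termSeq_dseq (d j : ℕ) (h1 : 1 ≤ j) (hj : j ≤ d) : DSeq ((d : ℝ) + 1) (termSeq d j) := by
  have h1' : (1 : ℝ) ≤ j := by exact_mod_cast h1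
  have hj' : (j : ℝ) ≤ d := by exact_mod_cast hj
  exact (((psiSeq_dseq.affine _ (by linarith)).add
    ((gapSeq_dseq _ (by linarith)).affine _ (by linarith))).add
    (((recSeq_dseq _ _ (by linarith)).smul _).sub ((recSeq_dseq _ _ (by linarith)).smul _))).add
    (constSeq_dseq _ _)

lemma termSeq_pos (d j : ℕ) (h1 : 1 ≤ j) (hj : j ≤ d) (k : ℕ) (x : ℝ) (hx : (d : ℝ) + 1 < x) :
    0 < termSeq d j k x := by
  have h1' : (1 : ℝ) ≤ j := by exact_mod_cast h1
  have hj' : (j : ℝ) ≤ d := by exact_mod_cast hj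
  have hy : 0 < (x + (1 - j)) / 2 := by linarith
  have p1 := psiSeq_nonneg k _ hy
  have p2 := gapSeq_nonneg (((j : ℝ) - 1) / 2) (by linarith) k _ hy
  have p3 : 0 ≤ constSeq 1 k x := by cases k <;> simp [constSeq]
  have p4 : recSeq (1 - j) k x < recSeq (-d - 1) k x := by
    unfold recSeq
    have : 0 < x + (-d - 1) := by linarith
    exact div_lt_div_of_pos_left (by positivity) (by positivity)
      (pow_lt_pow_left₀ (by linarith) this.le (by omega))
  have p5 : 0 < recSeq (1 - j) k x := by
    unfold recSeq
    have : 0 < x + (1 - j) := by linarith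
    positivity
  have p6 : (j + 1 : ℝ) * recSeq (1 - j) k x < (d + 1 : ℝ) * recSeq (-d - 1) k x := by
    calc (j + 1 : ℝ) * recSeq (1 - j) k x ≤ (d + 1 : ℝ) * recSeq (1 - j) k x := by gcongr
      _ < _ := by gcongr
  have p7 : 0 ≤ psiSeq k ((x + (1 - j)) / 2) / 2 ^ k := by positivity
  have p8 : 0 ≤ gapSeq (((j : ℝ) - 1) / 2) k ((x + (1 - j)) / 2) / 2 ^ k := by positivity
  unfold termSeq
  linarith

lemma termSeq_zero (d j : ℕ) (h1 : 1 ≤ j) (hj : j ≤ d) (x : ℝ) (hx : (d : ℝ) + 1 < x) :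
    termSeq d j 0 x = digamma ((x - j + 1) / 2) - Real.log (x / 2) + x / (x - d - 1) := by
  have h1' : (1 : ℝ) ≤ j := by exact_mod_cast h1
  have hj' : (j : ℝ) ≤ d := by exact_mod_cast hj
  have hy : 0 < (x + (1 - j)) / 2 := by linarith
  have e1 : x - j + 1 = x + (1 - j) := by ring
  have e2 : (x + (1 - j)) / 2 + ((j : ℝ) - 1) / 2 = x / 2 := by ring
  have e3 : psiSeq 0 ((x + (1 - j)) / 2) = _ := (digamma_hasSum _ hy).tsum_eq
  have e4 : x / (x - d - 1) = 1 + (d + 1) * (1 / (x + (-d - 1))) := by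
    have : x - d - 1 ≠ 0 := by linarith
    have e : x + (-d - 1) = x - d - 1 := by ring
    rw [e]
    field_simp
    ring
  rw [termSeq, e3, e1, e4]
  simp only [gapSeq, logSeq, recSeq, constSeq, e2]
  have : x + (1 - (j : ℝ)) ≠ 0 := by linarith
  simp only [Nat.factorial, Nat.cast_one, add_zero, zero_add, pow_one, pow_zero, div_one]
  generalize x + (1 - (j : ℝ)) = z at *
  field_simp
  ring

theorem fFun_completely_monotone (d : ℕ) (hd : 1 ≤ d) :
    ∀ (k : ℕ) (x : ℝ), (d : ℝ) + 1 < x →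
      0 < (-1 : ℝ) ^ k * iteratedDeriv k (fFun d) x := by
  intro k x hx
  have hD : DSeq ((d : ℝ) + 1) (fun k x => ∑ j ∈ Finset.Icc 1 d, termSeq d j k x) :=
    DSeq.sum fun j hj => termSeq_dseq d j (Finset.mem_Icc.1 hj).1 (Finset.mem_Icc.1 hj).2
  rw [hD.iteratedDeriv (f := fFun d) ?_ k x hx, ← mul_assoc, ← mul_pow]
  · norm_num
    exact Finset.sum_pos (fun j hj => termSeq_pos d j (Finset.mem_Icc.1 hj).1
      (Finset.mem_Icc.1 hj).2 k x hx) ⟨1, Finset.mem_Icc.2 ⟨le_rfl, hd⟩⟩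
  · intro x hx
    rw [Finset.sum_congr rfl fun j hj => termSeq_zero d j (Finset.mem_Icc.1 hj).1
      (Finset.mem_Icc.1 hj).2 x hx]
    rw [Finset.sum_add_distrib, Finset.sum_sub_distrib]
    simp only [Finset.sum_const, Nat.card_Icc, add_tsub_cancel_right, nsmul_eq_mul, fFun]
    ring
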